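/- (Nonnegativity of the concentration field.) Let n ≥ 1 and let Ω ⊆ ℝⁿ be a nonempty open bounded set. Let c : ℝⁿ → ℝ be continuous on the closure cl(Ω) and twice continuously differentiable on Ω, and let D : ℝⁿ → (real n×n matrices) be continuously differentiable on Ω, with D(x) symmetric for every x ∈ Ω and uniformly elliptic: there exist constants 0 < c₁ ≤ c₂ < ∞ such that c₁‖y‖² ≤ yᵀ D(x) y ≤ c₂‖y‖² for all x ∈ Ω and y ∈ ℝⁿ. Suppose −div[D grad c](x) = −Σ_{i} ∂_i ( Σ_{j} D_{ij}(x) ∂_j c(x) ) ≥ 0 for all x ∈ Ω (nonnegative volumetric source m ≥ 0), and c(x) ≥ 0 for all x on the frontier ∂Ω (nonnegative prescribed boundary concentration c^p ≥ 0). Then c(x) ≥ 0 for all x ∈ cl(Ω). -/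

import Mathlib

open Matrix

/-- The `i`-th partial derivative of a scalar field on `ℝⁿ` (Euclidean space). -/
noncomputable def partialDeriv' {n : ℕ} (f : EuclideanSpace ℝ (Fin n) → ℝ)
    (i : Fin n) (x : EuclideanSpace ℝ (Fin n)) : ℝ :=
  fderiv ℝ f x (EuclideanSpace.single i 1)

/-- The divergence-form operator `div[D grad c] (x) = Σᵢ ∂ᵢ (Σⱼ D i j ∂ⱼ c)`. -/
noncomputable def divDgrad {n : ℕ}
    (D : EuclideanSpace ℝ (Fin n) → Matrix (Fin n) (Fin n) ℝ)
    (c : EuclideanSpace ℝ (Fin n) → ℝ) (x : EuclideanSpace ℝ (Fin n)) : ℝ :=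
  ∑ i, partialDeriv' (fun y => ∑ j, D y i j * partialDeriv' c j y) i x

lemma second_order_aux {n : ℕ} (w : EuclideanSpace ℝ (Fin n) → ℝ) (x v : EuclideanSpace ℝ (Fin n))
    (hw : ContDiffAt ℝ 2 w x) (hmin : IsLocalMin w x) :
    0 ≤ fderiv ℝ (fderiv ℝ w) x v v := by
  have hline : ∀ t : ℝ, HasDerivAt (fun t : ℝ => x + t • v) v t := by
    intro t
    simpa using ((hasDerivAt_id t).smul_const v).const_add x
  have hcont : ContinuousAt (fun t : ℝ => x + t • v) 0 := (hline 0).continuousAt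
  have hx0 : x + (0 : ℝ) • v = x := by simp
  have hT : Filter.Tendsto (fun t : ℝ => x + t • v) (nhds 0) (nhds x) := by
    have := hcont.tendsto
    simpa using this
  have hev : ∀ᶠ y in nhds x, DifferentiableAt ℝ w y := by
    filter_upwards [hw.eventually (by simp)] with y hy
    exact hy.differentiableAt (by norm_num)
  have hd1 : ∀ᶠ t in nhds (0 : ℝ), deriv (fun t : ℝ => w (x + t • v)) t
      = fderiv ℝ w (x + t • v) v := by
    filter_upwards [hT.eventually hev] with t ht
    exact (ht.hasFDerivAt.comp_hasDerivAt t (hline t)).deriv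
  have hdd : DifferentiableAt ℝ (fderiv ℝ w) x :=
    (hw.fderiv_right (m := 1) (by norm_num)).differentiableAt (by norm_num)
  have h2 : deriv (deriv (fun t : ℝ => w (x + t • v))) 0 = fderiv ℝ (fderiv ℝ w) x v v := by
    rw [Filter.EventuallyEq.deriv_eq hd1]
    have hF : HasFDerivAt (fderiv ℝ w) (fderiv ℝ (fderiv ℝ w) x) (x + (0 : ℝ) • v) := by
      rw [hx0]; exact hdd.hasFDerivAt
    have h3 := hF.comp_hasDerivAt (0 : ℝ) (hline 0)
    have h4 := h3.clm_apply (hasDerivAt_const (0 : ℝ) v)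
    simpa using h4.deriv
  by_contra hneg
  push Not at hneg
  have hgmin : IsLocalMin (fun t : ℝ => w (x + t • v)) 0 := by
    have := hT.eventually hmin
    filter_upwards [this] with t ht
    simpa using ht
  have hgmax : IsLocalMax (fun t : ℝ => w (x + t • v)) 0 := by
    apply isLocalMax_of_deriv_deriv_neg
    · rw [h2]; exact hneg
    · exact hgmin.deriv_eq_zero
    · have : ContinuousAt w (x + (0 : ℝ) • v) := by rw [hx0]; exact hw.continuousAt
      exact ContinuousAt.comp (f := fun t : ℝ => x + t • v) this hcont
  have hconst : (fun t : ℝ => w (x + t • v)) =ᶠ[nhds 0] fun _ => w x := by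
    filter_upwards [hgmin, hgmax] with t h1 h2
    simp only [zero_smul, add_zero] at h1 h2
    exact le_antisymm h2 h1
  have := hconst.deriv.deriv_eq
  rw [h2] at this
  simp at this
  linarith

lemma trace_aux {n : ℕ} (A H : Matrix (Fin n) (Fin n) ℝ) (hA : A.PosSemidef)
    (hH : ∀ v : Fin n → ℝ, 0 ≤ v ⬝ᵥ H.mulVec v) : 0 ≤ ∑ i, ∑ j, A i j * H i j := by
  obtain ⟨B, rfl⟩ : ∃ B : Matrix (Fin n) (Fin n) ℝ, A = Bᴴ * B := by
    open scoped MatrixOrder in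
    exact CStarAlgebra.nonneg_iff_eq_star_mul_self.mp (Matrix.nonneg_iff_posSemidef.mpr hA)
  have : ∑ i, ∑ j, (Bᴴ * B) i j * H i j = ∑ k, (B k) ⬝ᵥ H.mulVec (B k) := by
    simp only [Matrix.mul_apply, dotProduct, Matrix.mulVec, Finset.mul_sum, Finset.sum_mul,
      Matrix.conjTranspose_apply, star_trivial]
    calc _ = ∑ i, ∑ k, ∑ j, B k i * B k j * H i j :=
          Finset.sum_congr rfl fun i _ => Finset.sum_comm
      _ = ∑ k, ∑ i, ∑ j, B k i * B k j * H i j := Finset.sum_comm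
      _ = _ := by
          refine Finset.sum_congr rfl fun k _ => Finset.sum_congr rfl fun i _ =>
            Finset.sum_congr rfl fun j _ => ?_
          ring
  rw [this]
  exact Finset.sum_nonneg fun k _ => hH _

lemma divDgrad_eq_aux {n : ℕ} (D : EuclideanSpace ℝ (Fin n) → Matrix (Fin n) (Fin n) ℝ)
    (f : EuclideanSpace ℝ (Fin n) → ℝ) (x : EuclideanSpace ℝ (Fin n))
    (hD : ∀ i j, DifferentiableAt ℝ (fun x => D x i j) x)
    (hf : DifferentiableAt ℝ (fderiv ℝ f) x) :
    divDgrad D f x = ∑ i, ∑ j, (D x i j *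
        fderiv ℝ (fderiv ℝ f) x (EuclideanSpace.single i 1) (EuclideanSpace.single j 1)
      + fderiv ℝ f x (EuclideanSpace.single j 1) *
        fderiv ℝ (fun x => D x i j) x (EuclideanSpace.single i 1)) := by
  unfold divDgrad partialDeriv'
  refine Finset.sum_congr rfl fun i _ => ?_
  have h : HasFDerivAt (fun y => ∑ j, D y i j * fderiv ℝ f y (EuclideanSpace.single j 1)) _ x :=
    HasFDerivAt.fun_sum (u := Finset.univ) fun j _ =>
      (hD i j).hasFDerivAt.mul (hf.hasFDerivAt.clm_apply
        (hasFDerivAt_const (EuclideanSpace.single j (1 : ℝ)) x))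
  rw [h.fderiv]
  simp [ContinuousLinearMap.sum_apply]

lemma exp_aux {n : ℕ} (i0 : Fin n) (γ : ℝ) (x : EuclideanSpace ℝ (Fin n)) :
    HasFDerivAt (fun y : EuclideanSpace ℝ (Fin n) => Real.exp (γ * y i0))
      ((γ * Real.exp (γ * x i0)) • (EuclideanSpace.proj i0 : EuclideanSpace ℝ (Fin n) →L[ℝ] ℝ)) x := by
  have h := (((EuclideanSpace.proj i0 : EuclideanSpace ℝ (Fin n) →L[ℝ] ℝ).hasFDerivAt
    (x := x)).const_mul γ).exp
  refine h.congr_fderiv ?_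
  rw [smul_smul, mul_comm γ (Real.exp (γ * x i0))]
  rfl

lemma exp_aux2 {n : ℕ} (i0 : Fin n) (γ : ℝ) (x u v : EuclideanSpace ℝ (Fin n)) :
    fderiv ℝ (fderiv ℝ (fun y : EuclideanSpace ℝ (Fin n) => Real.exp (γ * y i0))) x u v =
      γ ^ 2 * Real.exp (γ * x i0) * (u i0 * v i0) := by
  have h : fderiv ℝ (fun y : EuclideanSpace ℝ (Fin n) => Real.exp (γ * y i0)) =
    fun x => (γ * Real.exp (γ * x i0)) • (EuclideanSpace.proj i0 : EuclideanSpace ℝ (Fin n) →L[ℝ] ℝ) := by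
    funext x
    exact (exp_aux i0 γ x).fderiv
  rw [h]
  have h2 := ((exp_aux i0 γ x).const_mul γ).smul_const
    (EuclideanSpace.proj i0 : EuclideanSpace ℝ (Fin n) →L[ℝ] ℝ)
  rw [h2.fderiv]
  simp
  ring

lemma psd_aux {n : ℕ} (A : Matrix (Fin n) (Fin n) ℝ) (hs : A.IsSymm) (c₁ : ℝ) (hc₁ : 0 < c₁)
    (h : ∀ y : Fin n → ℝ, c₁ * (y ⬝ᵥ y) ≤ y ⬝ᵥ A.mulVec y) : A.PosSemidef := by
  refine Matrix.PosSemidef.of_dotProduct_mulVec_nonneg ?_ ?_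
  · ext i j
    simpa using congrFun (congrFun hs i) j
  · intro y
    refine le_trans (mul_nonneg hc₁.le ?_) (h y)
    exact Finset.sum_nonneg fun i _ => mul_self_nonneg _

/-- nonnegativity of the concentration field: if `c` is continuous
on `cl(Ω)` and `C²` on the open bounded set `Ω`, the diffusivity field `D` is `C¹`,
symmetric and uniformly elliptic on `Ω`, the source `m = -div[D grad c]` is
nonnegative on `Ω`, and `c ≥ 0` on the boundary `∂Ω`, then `c ≥ 0` on `cl(Ω)`. -/
theorem concentration_nonneg
    (n : ℕ) (hn : 1 ≤ n) (Ω : Set (EuclideanSpace ℝ (Fin n)))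
    (hΩne : Ω.Nonempty) (hΩopen : IsOpen Ω) (hΩbdd : Bornology.IsBounded Ω)
    (c : EuclideanSpace ℝ (Fin n) → ℝ)
    (hc_cont : ContinuousOn c (closure Ω))
    (hc_smooth : ContDiffOn ℝ 2 c Ω)
    (D : EuclideanSpace ℝ (Fin n) → Matrix (Fin n) (Fin n) ℝ)
    (hD_smooth : ∀ i j, ContDiffOn ℝ 1 (fun x => D x i j) Ω)
    (hD_symm : ∀ x ∈ Ω, (D x).IsSymm)
    (c₁ c₂ : ℝ) (hc₁ : 0 < c₁) (hc₁₂ : c₁ ≤ c₂)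
    (hD_elliptic : ∀ x ∈ Ω, ∀ y : Fin n → ℝ,
      c₁ * (y ⬝ᵥ y) ≤ y ⬝ᵥ (D x).mulVec y ∧ y ⬝ᵥ (D x).mulVec y ≤ c₂ * (y ⬝ᵥ y))
    (hsource : ∀ x ∈ Ω, 0 ≤ -divDgrad D c x)
    (hbdry : ∀ x ∈ frontier Ω, 0 ≤ c x) :
    ∀ x ∈ closure Ω, 0 ≤ c x := by
  classical
  by_contra hcon
  push Not at hcon
  obtain ⟨z, hz, hzneg⟩ := hcon
  set i0 : Fin n := ⟨0, hn⟩
  have hcomp : IsCompact (closure Ω) := hΩbdd.isCompact_closure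
  obtain ⟨x0, hx0, hx0min⟩ := hcomp.exists_isMinOn ⟨z, hz⟩ hc_cont
  set m : ℝ := - c x0 with hm
  have hmpos : 0 < m := by
    have : c x0 ≤ c z := hx0min hz
    linarith
  set K : Set (EuclideanSpace ℝ (Fin n)) := closure Ω ∩ c ⁻¹' Set.Iic (-m / 2) with hK
  have hKc : IsCompact K :=
    hcomp.of_isClosed_subset (hc_cont.preimage_isClosed_of_isClosed isClosed_closure isClosed_Iic)
      Set.inter_subset_left
  have hKΩ : K ⊆ Ω := by
    rintro x ⟨hx, hxc⟩
    rw [closure_eq_self_union_frontier] at hx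
    rcases hx with hx | hx
    · exact hx
    · have := hbdry x hx
      simp only [Set.mem_preimage, Set.mem_Iic] at hxc
      linarith
  have hdrift : ContinuousOn (fun x => ∑ i, fderiv ℝ (fun x => D x i i0) x
      (EuclideanSpace.single i 1)) K := by
    refine continuousOn_finset_sum _ fun i _ => ?_
    exact (((hD_smooth i i0).continuousOn_fderiv_of_isOpen hΩopen (by norm_num)).mono hKΩ).clm_apply
      continuousOn_const
  obtain ⟨M, hM⟩ := hKc.exists_bound_of_continuousOn hdrift
  set γ : ℝ := (|M| + 1) / c₁ with hγ
  have hγpos : 0 < γ := by positivity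
  set P : EuclideanSpace ℝ (Fin n) → ℝ := fun y => Real.exp (γ * y i0) with hP
  have hPcd : ContDiff ℝ 2 P := by
    have : ContDiff ℝ 2 (fun y : EuclideanSpace ℝ (Fin n) => y i0) :=
      (EuclideanSpace.proj i0 : EuclideanSpace ℝ (Fin n) →L[ℝ] ℝ).contDiff
    exact (contDiff_const.mul this).exp
  obtain ⟨B, hB⟩ := hcomp.exists_bound_of_continuousOn hPcd.continuous.continuousOn
  have hPpos : ∀ x, 0 < P x := fun x => Real.exp_pos _
  have hPB : ∀ x ∈ closure Ω, P x ≤ B := fun x hx => (le_abs_self _).trans (hB x hx)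
  have hBpos : 0 < B := (hPpos x0).trans_le (hPB x0 hx0)
  set ε : ℝ := m / (2 * B) with hε
  have hεpos : 0 < ε := by positivity
  have hεB : ε * B = m / 2 := by rw [hε]; field_simp
  obtain ⟨x, hx, hxmin⟩ := hcomp.exists_isMinOn (f := fun y => c y - ε * P y) ⟨z, hz⟩
    (hc_cont.sub (hPcd.continuous.continuousOn.const_mul ε))
  have hxK : x ∈ K := by
    refine ⟨hx, ?_⟩
    have h1 : c x - ε * P x ≤ c x0 - ε * P x0 := hxmin hx0
    have h2 : ε * P x ≤ ε * B := mul_le_mul_of_nonneg_left (hPB x hx) hεpos.le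
    have h3 : 0 < ε * P x0 := mul_pos hεpos (hPpos x0)
    simp only [Set.mem_preimage, Set.mem_Iic]
    linarith
  have hxΩ := hKΩ hxK
  have hnx : Ω ∈ nhds x := hΩopen.mem_nhds hxΩ
  have hlm : IsLocalMin (fun y => c y - ε * P y) x :=
    hxmin.isLocalMin (Filter.mem_of_superset hnx subset_closure)
  have hcx : ContDiffAt ℝ 2 c x := hc_smooth.contDiffAt hnx
  have hwx : ContDiffAt ℝ 2 (fun y => c y - ε * P y) x :=
    hcx.sub (contDiffAt_const.mul hPcd.contDiffAt)
  have hfd : ∀ y ∈ Ω, fderiv ℝ (fun y => c y - ε * P y) y = fderiv ℝ c y - ε • fderiv ℝ P y := by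
    intro y hy
    have h1 : DifferentiableAt ℝ c y :=
      (hc_smooth.contDiffAt (hΩopen.mem_nhds hy)).differentiableAt (by norm_num)
    have h2 : DifferentiableAt ℝ P y := hPcd.contDiffAt.differentiableAt (by norm_num)
    exact (h1.hasFDerivAt.sub (h2.hasFDerivAt.const_mul ε)).fderiv
  have hgrad : fderiv ℝ c x = ε • fderiv ℝ P x := by
    have h := hlm.fderiv_eq_zero
    rw [hfd x hxΩ] at h
    exact sub_eq_zero.mp h
  have hdc : DifferentiableAt ℝ (fderiv ℝ c) x :=
    (hcx.fderiv_right (m := 1) (by norm_num)).differentiableAt (by norm_num)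
  have hdP : DifferentiableAt ℝ (fderiv ℝ P) x :=
    (hPcd.contDiffAt.fderiv_right (m := 1) (by norm_num)).differentiableAt (by norm_num)
  have hhess : fderiv ℝ (fderiv ℝ (fun y => c y - ε * P y)) x =
      fderiv ℝ (fderiv ℝ c) x - ε • fderiv ℝ (fderiv ℝ P) x := by
    have : fderiv ℝ (fun y => c y - ε * P y) =ᶠ[nhds x] fun y => fderiv ℝ c y - ε • fderiv ℝ P y := by
      filter_upwards [hnx] with y hy using hfd y hy
    rw [this.fderiv_eq]
    exact (hdc.hasFDerivAt.sub (hdP.hasFDerivAt.const_smul ε)).fderiv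
  have hDd : ∀ i j, DifferentiableAt ℝ (fun x => D x i j) x := fun i j =>
    ((hD_smooth i j).contDiffAt hnx).differentiableAt (by norm_num)
  set W := fderiv ℝ (fderiv ℝ (fun y => c y - ε * P y)) x with hW
  have htr : 0 ≤ ∑ i, ∑ j, D x i j *
      (W (EuclideanSpace.single i 1) (EuclideanSpace.single j 1)) := by
    refine trace_aux (D x) (Matrix.of fun i j => W (EuclideanSpace.single i 1)
      (EuclideanSpace.single j 1)) (psd_aux _ (hD_symm x hxΩ) c₁ hc₁
      fun y => (hD_elliptic x hxΩ y).1) ?_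
    intro v
    have h := second_order_aux _ x (∑ i, v i • EuclideanSpace.single i (1 : ℝ)) hwx hlm
    rw [← hW] at h
    convert h using 1
    simp only [map_sum, map_smul, ContinuousLinearMap.sum_apply, ContinuousLinearMap.smul_apply,
      dotProduct, Matrix.mulVec, Matrix.of_apply, smul_eq_mul, Finset.mul_sum]
    first
    | (refine Finset.sum_congr rfl fun i _ => Finset.sum_congr rfl fun j _ => ?_; ring1)
    | (rw [Finset.sum_comm]; refine Finset.sum_congr rfl fun i _ => Finset.sum_congr rfl fun j _ => ?_; ring1)
  have hLc : divDgrad D c x = (∑ i, ∑ j, D x i j *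
      (W (EuclideanSpace.single i 1) (EuclideanSpace.single j 1))) + ε * divDgrad D P x := by
    rw [divDgrad_eq_aux D c x hDd hdc, divDgrad_eq_aux D P x hDd hdP, hhess, hgrad]
    simp only [Finset.mul_sum, ← Finset.sum_add_distrib]
    refine Finset.sum_congr rfl fun i _ => Finset.sum_congr rfl fun j _ => ?_
    simp only [ContinuousLinearMap.sub_apply, ContinuousLinearMap.smul_apply, smul_eq_mul]
    ring
  have hLP : divDgrad D P x = P x * γ * (γ * D x i0 i0 +
      ∑ i, fderiv ℝ (fun x => D x i i0) x (EuclideanSpace.single i 1)) := by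
    rw [divDgrad_eq_aux D P x hDd hdP]
    simp only [hP, exp_aux2, (exp_aux i0 γ x).fderiv]
    simp [Finset.sum_add_distrib, PiLp.single_apply, mul_add, Finset.mul_sum, Finset.sum_ite_eq]
    ring_nf
    try simp
  have hD00 : c₁ ≤ D x i0 i0 := by
    have := (hD_elliptic x hxΩ (Pi.single i0 1)).1
    simpa using this
  have hMx := hM x hxK
  rw [Real.norm_eq_abs] at hMx
  have hge := (abs_le.mp hMx).1
  have h1 : γ * c₁ = |M| + 1 := by rw [hγ]; field_simp
  have h2 : γ * c₁ ≤ γ * D x i0 i0 := mul_le_mul_of_nonneg_left hD00 hγpos.le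
  have h3 := le_abs_self M
  have hLPpos : 0 < divDgrad D P x := by
    rw [hLP]
    exact mul_pos (mul_pos (hPpos x) hγpos) (by linarith)
  have := hsource x hxΩ
  have := mul_pos hεpos hLPpos
  linarith
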